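/- Let n ≥ 4, let φ : A* → DPS_n be the monoid homomorphism from the free monoid on A = {a₁,a₂,b₁,b₂,c} extending a₁ ↦ α₁, a₂ ↦ α₂, b₁ ↦ β₁, b₂ ↦ β₂, c ↦ γ, and let ρ_R be the smallest congruence on A* containing the relation set R. Let w₁ be a word over A containing at least one occurrence of c and let w₂ be any word over A such that the numbers |w₁|_c and |w₂|_c of occurrences of c have the same parity. If φ(w₁) = φ(w₂), then w₁ = w₂ is a consequence of R, i.e., (w₁,w₂) ∈ ρ_R. -/

import Mathlib

namespace DPSPaper

instance instMonoidPFun {V : Type*} : Monoid (V →. V) where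
  mul f g := g.comp f
  one := PFun.id V
  mul_assoc a b c := (PFun.comp_assoc c b a).symm
  one_mul := PFun.comp_id
  mul_one := PFun.id_comp

/-- The geodesic distance in the star graph `S_n` on vertices `{0,1,...,n-1}`. -/
def starDist (n : ℕ) (x y : Fin n) : ℕ :=
  if x = y then 0 else if (x : ℕ) = 0 ∨ (y : ℕ) = 0 then 1 else 2

/-- Injectivity of a partial map. -/
def PInj {n : ℕ} (α : Fin n →. Fin n) : Prop :=
  ∀ ⦃x y a : Fin n⦄, a ∈ α x → a ∈ α y → x = y

/-- `α` is a partial isometry of the star graph `S_n`. -/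
def IsStarPI {n : ℕ} (α : Fin n →. Fin n) : Prop :=
  PInj α ∧ ∀ ⦃x y u v : Fin n⦄, u ∈ α x → v ∈ α y → starDist n u v = starDist n x y

/-- The set of all partial isometries of `S_n`. -/
def DPSset (n : ℕ) : Set (Fin n →. Fin n) := { α | IsStarPI α }

/-- `α₁` : fixes 0, sends `i ↦ i+1` for `1 ≤ i ≤ n-2`, and `n-1 ↦ 1`. -/
def alphaOne (n : ℕ) (hn : 3 ≤ n) : Fin n →. Fin n :=
  fun x => Part.some <|
    if (x : ℕ) = 0 then x
    else if h : (x : ℕ) = n - 1 then ⟨1, by omega⟩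
    else ⟨(x : ℕ) + 1, by have := x.isLt; omega⟩

/-- `α₂` : fixes 0 and every `i ≥ 3`, swaps 1 and 2. -/
def alphaTwo (n : ℕ) (hn : 3 ≤ n) : Fin n →. Fin n :=
  fun x => Part.some <|
    if (x : ℕ) = 1 then ⟨2, by omega⟩
    else if (x : ℕ) = 2 then ⟨1, by omega⟩
    else x

/-- `β₁` : the partial identity on `{0,1,...,n-2}`. -/
def betaOne (n : ℕ) : Fin n →. Fin n :=
  fun x => if (x : ℕ) ≤ n - 2 then Part.some x else Part.none

/-- `β₂` : the partial identity on `{1,...,n-1}`. -/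
def betaTwo (n : ℕ) : Fin n →. Fin n :=
  fun x => if (x : ℕ) = 0 then Part.none else Part.some x

/-- `γ` : domain `{0,1}`, sending `0 ↦ 1` and `1 ↦ 0`. -/
def gammaMap (n : ℕ) (hn : 3 ≤ n) : Fin n →. Fin n :=
  fun x =>
    if (x : ℕ) = 0 then Part.some ⟨1, by omega⟩
    else if (x : ℕ) = 1 then Part.some ⟨0, by omega⟩
    else Part.none

/-- The five-letter alphabet `A = {a₁, a₂, b₁, b₂, c}`. -/
inductive Gen : Type
  | a1 | a2 | b1 | b2 | c
deriving DecidableEq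

abbrev W := FreeMonoid Gen

def wa1 : W := FreeMonoid.of Gen.a1
def wa2 : W := FreeMonoid.of Gen.a2
def wb1 : W := FreeMonoid.of Gen.b1
def wb2 : W := FreeMonoid.of Gen.b2
def wc  : W := FreeMonoid.of Gen.c

/-- The set `R` of `3n+9` defining relations over the alphabet `A`. -/
def Rrel (n : ℕ) : W → W → Prop := fun u v =>
  (u = wa2 ^ 2 ∧ v = 1) ∨
  (u = wa1 ^ (n - 1) ∧ v = 1) ∨
  (u = (wa1 * wa2) ^ (n - 2) ∧ v = 1) ∨
  (u = (wa2 * wa1 ^ (n - 2) * wa2 * wa1) ^ 3 ∧ v = 1) ∨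
  (∃ j, 2 ≤ j ∧ j ≤ n - 3 ∧ u = (wa2 * wa1 ^ (n - 1 - j) * wa2 * wa1 ^ j) ^ 2 ∧ v = 1) ∨
  (u = wb1 ^ 2 ∧ v = wb1) ∨
  (u = wb2 ^ 2 ∧ v = wb2) ∨
  (u = wa2 * wb1 ∧ v = wb1 * wa2) ∨
  (u = wb2 * wa2 ∧ v = wa2 * wb2) ∨
  (u = wb2 * wa1 ∧ v = wa1 * wb2) ∨
  (u = wb2 * wb1 ∧ v = wb1 * wb2) ∨
  (u = wa1 * wa2 * wa1 ^ (n - 2) * wb1 * wa1 * wa2 * wa1 ^ (n - 2) ∧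
    v = wa1 ^ (n - 2) * wb1 * wa1) ∨
  (u = (wa1 ^ (n - 2) * wb1 * wa1 * wa2) ^ 2 ∧ v = (wa2 * wa1 ^ (n - 2) * wb1 * wa1) ^ 2) ∨
  (u = wa1 ^ (n - 2) * wb1 * wa1 * wa2 * wa1 ^ (n - 2) * wb1 * wa1 ∧
    v = (wa2 * wa1 ^ (n - 2) * wb1 * wa1) ^ 2) ∨
  (u = wc ^ 3 ∧ v = wc) ∨
  (u = wc * wa1 ∧ v = wc * wa2) ∨
  (u = wa1 ^ (n - 2) * wc ∧ v = wa2 * wc) ∨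
  (∃ j, 1 ≤ j ∧ j ≤ n - 3 ∧ u = wa2 * wa1 ^ j * wc ∧ v = wa1 ^ j * wc) ∨
  (u = wb1 * wa1 * wc ∧ v = wc * wb2) ∨
  (∃ j, 2 ≤ j ∧ j ≤ n - 3 ∧ u = wb1 * wa1 ^ j * wc ∧ v = wa1 ^ j * wc) ∨
  (u = (wb1 * wa1) ^ (n - 3) * wb1 ∧ v = wc ^ 2 * wa2 * wa1 ^ (n - 4)) ∨
  (u = wb2 * wc ^ 2 ∧ v = wc * wa2 * wc) ∨
  (u = (wb2 * wc) ^ 2 ∧ v = wb2 * wc * wb2)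

/-- The images of the generators. -/
def genMap (n : ℕ) (hn : 3 ≤ n) : Gen → (Fin n →. Fin n)
  | Gen.a1 => alphaOne n hn
  | Gen.a2 => alphaTwo n hn
  | Gen.b1 => betaOne n
  | Gen.b2 => betaTwo n
  | Gen.c  => gammaMap n hn

/-- The homomorphism `φ : A* → DPS_n` extending `a₁ ↦ α₁, a₂ ↦ α₂, b₁ ↦ β₁, b₂ ↦ β₂, c ↦ γ`. -/
def phi (n : ℕ) (hn : 3 ≤ n) : W →* (Fin n →. Fin n) :=
  FreeMonoid.lift (genMap n hn)

/-- The number of occurrences of the letter `x` in the word `w`. -/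
def cnt (x : Gen) (w : W) : ℕ := (FreeMonoid.toList w).count x

structure Rels (m : ℕ) {M : Type*} [Monoid M] (A : ZMod (m+3) → M) (s b d c : M) : Prop where
  A0 : A 0 = 1
  Aadd : ∀ x y, A (x+y) = A x * A y
  ss : s * s = 1
  scomm : ∀ j, j ≠ 0 → j ≠ 1 → j ≠ -1 → (s * A (-j) * s * A j)^2 = 1
  bb : b * b = b
  dd : d * d = d
  sb : s * b = b * s
  ds : d * s = s * d
  dA1 : d * A 1 = A 1 * d
  db : d * b = b * d
  r1 : A 1 * s * A (-1) * b * A 1 * s * A (-1) = A (-1) * b * A 1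
  r2 : (A (-1) * b * A 1 * s)^2 = (s * A (-1) * b * A 1)^2
  r3 : A (-1) * b * A 1 * s * A (-1) * b * A 1 = (s * A (-1) * b * A 1)^2
  ccc : c ^ 3 = c
  cA : c * A 1 = c * s
  Ac : A (-1) * c = s * c
  sAc : ∀ j, j ≠ 0 → j ≠ -1 → s * A j * c = A j * c
  bA1c : b * A 1 * c = c * d
  bAc : ∀ j, j ≠ 0 → j ≠ 1 → j ≠ -1 → b * A j * c = A j * c
  E : (b * A 1)^(m+1) * b = c^2 * s * A (-3)
  dcc : d * c^2 = c * s * c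
  dcd : (d * c)^2 = d * c * d

theorem one_ne0 (m : ℕ) : (1 : ZMod (m+3)) ≠ 0 := by
  intro h
  have := congrArg ZMod.val h
  rw [ZMod.val_one_eq_one_mod, ZMod.val_zero, Nat.mod_eq_of_lt (by omega)] at this
  omega

theorem two_ne0 (m : ℕ) : (1 + 1 : ZMod (m+3)) ≠ 0 := by
  intro h
  have h2 : ((2 : ℕ) : ZMod (m+3)) = 0 := by push_cast; rw [← h]; norm_num
  rw [ZMod.natCast_eq_zero_iff] at h2
  have := Nat.le_of_dvd (by omega) h2
  omega

theorem one_ne_neg (m : ℕ) : (1 : ZMod (m+3)) ≠ -1 := by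
  intro h
  apply two_ne0 m
  nth_rewrite 1 [h]
  simp

/-- Going around the cycle from `1` up to `-1`. -/
theorem cyc_ind (m : ℕ) (Q : ZMod (m+3) → Prop) (h1 : Q 1)
    (hs : ∀ x, x ≠ 0 → x ≠ -1 → Q x → Q (x+1)) : ∀ x, x ≠ 0 → Q x := by
  have key : ∀ k : ℕ, k < m + 2 → Q ((k + 1 : ℕ) : ZMod (m+3)) := by
    intro k
    induction k with
    | zero => intro _; simpa using h1
    | succ k ih =>
      intro hk
      have := hs _ ?_ ?_ (ih (by omega))
      · push_cast at this ⊢; exact this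
      · rw [Ne, ZMod.natCast_eq_zero_iff]
        intro h; have := Nat.le_of_dvd (by omega) h; omega
      · intro h
        have h2 : ((k + 2 : ℕ) : ZMod (m+3)) = 0 := by
          have : ((k + 2 : ℕ) : ZMod (m+3)) = ((k + 1 : ℕ) : ZMod (m+3)) + 1 := by
            push_cast; ring
          rw [this, h]; simp
        rw [ZMod.natCast_eq_zero_iff] at h2
        have := Nat.le_of_dvd (by omega) h2; omega
  intro x hx
  have hv : x.val ≠ 0 := by rwa [Ne, ZMod.val_eq_zero]
  have hlt := ZMod.val_lt x
  have := key (x.val - 1) (by omega)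
  rw [Nat.sub_add_cancel (by omega), ZMod.natCast_zmod_val] at this
  exact this

namespace Rels

variable {m : ℕ} {M : Type*} [Monoid M] {A : ZMod (m+3) → M} {s b d c : M}

theorem AnA (R : Rels m A s b d c) (x) : A (-x) * A x = 1 := by
  rw [← R.Aadd, neg_add_cancel, R.A0]

theorem AAn (R : Rels m A s b d c) (x) : A x * A (-x) = 1 := by
  rw [← R.Aadd, add_neg_cancel, R.A0]

theorem AnAw (R : Rels m A s b d c) (x) (w : M) : A (-x) * (A x * w) = w := by
  rw [← mul_assoc, R.AnA, one_mul]

theorem AAnw (R : Rels m A s b d c) (x) (w : M) : A x * (A (-x) * w) = w := by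
  rw [← mul_assoc, R.AAn, one_mul]

theorem AAw (R : Rels m A s b d c) (x y) (w : M) : A x * (A y * w) = A (x+y) * w := by
  rw [← mul_assoc, R.Aadd]

theorem ssw (R : Rels m A s b d c) (w : M) : s * (s * w) = w := by
  rw [← mul_assoc, R.ss, one_mul]

end Rels

/-- idempotent killing the leaf `x` -/
def ee {m : ℕ} {M : Type*} [Monoid M] (A : ZMod (m+3) → M) (b : M) (x : ZMod (m+3)) : M :=
  A (-1 - x) * b * A (x + 1)

/-- transposition of the leaves `x`, `x+1` -/
def sg {m : ℕ} {M : Type*} [Monoid M] (A : ZMod (m+3) → M) (s : M) (x : ZMod (m+3)) : M :=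
  A (-x) * s * A x

namespace Rels

variable {m : ℕ} {M : Type*} [Monoid M] {A : ZMod (m+3) → M} {s b d c : M}

theorem Ae (R : Rels m A s b d c) (k x) : A k * ee A b x = ee A b (x-k) * A k := by
  simp only [ee, mul_assoc, R.AAw, ← R.Aadd]
  congr 3 <;> ring

theorem Asg (R : Rels m A s b d c) (k x) : A k * sg A s x = sg A s (x-k) * A k := by
  simp only [sg, mul_assoc, R.AAw, ← R.Aadd]
  congr 3 <;> ring

theorem em1 (R : Rels m A s b d c) : ee A b (-1) = b := by
  simp [ee, R.A0]

theorem sg0 (R : Rels m A s b d c) : sg A s 0 = s := by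
  simp [sg, R.A0]

theorem sgsg (R : Rels m A s b d c) (x) : sg A s x * sg A s x = 1 := by
  simp only [sg, mul_assoc, R.AAnw, R.ssw, R.AnA]

theorem sgsgw (R : Rels m A s b d c) (x) (w : M) : sg A s x * (sg A s x * w) = w := by
  rw [← mul_assoc, R.sgsg, one_mul]

theorem eidem (R : Rels m A s b d c) (x) : ee A b x * ee A b x = ee A b x := by
  have : (A (x+1) * A (-1-x)) = 1 := by rw [← R.Aadd, ← R.A0]; congr 1; ring
  calc _ = A (-1-x) * b * (A (x+1) * A (-1-x)) * b * A (x+1) := by simp only [ee, mul_assoc]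
    _ = A (-1-x) * (b * b) * A (x+1) := by rw [this]; simp only [mul_assoc, one_mul]
    _ = _ := by rw [R.bb]; rfl

/-- transport of an equation between `e x * e y` etc along the cycle -/
theorem Acancel (R : Rels m A s b d c) (k) {u v : M} (h : A k * u = A k * v) : u = v := by
  have := congrArg (A (-k) * ·) h
  simpa only [R.AnAw] using this

theorem Acancelr (R : Rels m A s b d c) (k) {u v : M} (h : u * A k = v * A k) : u = v := by
  have := congrArg (· * A (-k)) h
  simpa only [mul_assoc, R.AAn, mul_one] using this

theorem e0 (R : Rels m A s b d c) : ee A b 0 = A (-1) * b * A 1 := by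
  simp [ee]

theorem se0 (R : Rels m A s b d c) : s * ee A b 0 = ee A b 1 * s := by
  have h := R.r1
  have h2 : A 1 * (s * ee A b 0 * s) = ee A b 0 * A 1 := by
    rw [R.e0]; nth_rewrite 2 [← h]
    simp only [mul_assoc, R.AnA, mul_one]
  have h3 : A 1 * ee A b 1 = ee A b 0 * A 1 := by rw [R.Ae]; simp
  have h4 := R.Acancel 1 (h2.trans h3.symm)
  rw [← h4]; simp only [mul_assoc, R.ss, mul_one]

theorem se1 (R : Rels m A s b d c) : s * ee A b 1 = ee A b 0 * s := by
  have : s * (s * ee A b 0) * s = s * (ee A b 1 * s) * s := by rw [R.se0]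
  simp only [mul_assoc, R.ss, mul_one, R.ssw] at this
  exact this.symm

theorem sgcomm0 (R : Rels m A s b d c) (j) (h0 : j ≠ 0) (h1 : j ≠ 1) (h2 : j ≠ -1) :
    s * sg A s j = sg A s j * s := by
  have h := R.scomm j h0 h1 h2
  have h' : (s * sg A s j) * (s * sg A s j) = 1 := by
    rw [← h, pow_two]; simp only [sg, mul_assoc]
  have := congrArg (fun t => s * t * (sg A s j)) h'
  simp only [mul_assoc, R.sgsg, mul_one, R.ssw, one_mul] at this
  have h3 := congrArg (s * ·) this
  simp only [R.ssw] at h3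
  have h4 := congrArg (s * ·) h'
  simp only [mul_assoc, R.ssw, mul_one] at h4
  have h5 := congrArg (sg A s j * ·) h4
  simp only [R.sgsgw] at h5
  exact h5

theorem sgcomm (R : Rels m A s b d c) (k j) (h0 : j ≠ k) (h1 : j ≠ k + 1) (h2 : j ≠ k -1) :
    sg A s k * sg A s j = sg A s j * sg A s k := by
  have := R.sgcomm0 (j - k) (by rwa [sub_ne_zero]) (by rwa [Ne, sub_eq_iff_eq_add'])
    (by intro h; apply h2; rw [sub_eq_iff_eq_add'] at h; rw [h]; ring)
  nth_rewrite 1 [← R.sg0] at this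
  nth_rewrite 4 [← R.sg0] at this
  apply R.Acancel k
  calc _ = sg A s 0 * sg A s (j-k) * A k := by
        rw [← mul_assoc, R.Asg, mul_assoc, R.Asg, ← mul_assoc, sub_self]
    _ = _ := by rw [this, ← mul_assoc, R.Asg, mul_assoc, mul_assoc, R.Asg, sub_self]

theorem bsg (R : Rels m A s b d c) : ∀ k, k ≠ -1 → k ≠ -2 → b * sg A s k = sg A s k * b := by
  have key : ∀ x : ZMod (m+3), x ≠ 0 → x ≠ -1 → b * sg A s (x-1) = sg A s (x-1) * b := by
    apply cyc_ind m (fun x => x ≠ -1 → b * sg A s (x-1) = sg A s (x-1) * b)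
    · intro _; rw [sub_self, R.sg0, R.sb]
    · intro x hx hx1 ih hx2
      have ih := ih hx1
      -- conjugation by z
      have hz : (A 2 * s * A (-1)) * b = b * (A 2 * s * A (-1)) := by
        apply R.Acancelr 2
        calc _ = A 2 * s * (A (-1) * ee A b (-1)) * A 2 := by rw [R.em1]; simp only [mul_assoc]
          _ = A 2 * (s * ee A b 0) * A (-1) * A 2 := by rw [R.Ae]; simp [mul_assoc]
          _ = A 2 * ee A b 1 * s * A (-1) * A 2 := by rw [R.se0]; simp [mul_assoc]
          _ = ee A b (-1) * A 2 * s * A (-1) * A 2 := by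
              rw [R.Ae, show (1 - 2 : ZMod (m+3)) = -1 by ring]
          _ = _ := by rw [R.em1]; simp only [mul_assoc]
      have hz' : (A 1 * s * A (-2)) * b = b * (A 1 * s * A (-2)) := by
        have := congrArg (fun t => (A 1 * s * A (-2)) * t * (A 1 * s * A (-2))) hz
        simp only [mul_assoc, R.AnAw, R.AnA, R.ssw, R.AAnw, R.AAn, R.ss, mul_one] at this
        simp only [mul_assoc]; exact this.symm
      have hc : (A 1 * s * A (-2)) * sg A s (x-1) * (A 2 * s * A (-1)) = sg A s (x+1-1) := by
        have h1 : A (-2) * sg A s (x-1) * A 2 = A (-1) * sg A s x * A 1 := by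
          rw [R.Asg, R.Asg, mul_assoc, mul_assoc, R.AnA, R.AnA]; congr 2; ring
        have h2 : (A 1 * s * A (-1)) = sg A s (-1) := by simp [sg]
        calc _ = A 1 * s * (A (-2) * sg A s (x-1) * A 2) * s * A (-1) := by simp only [mul_assoc]
          _ = sg A s (-1) * sg A s x * sg A s (-1) := by rw [h1, ← h2]; simp only [mul_assoc]
          _ = sg A s x := by
            rw [R.sgcomm, mul_assoc, R.sgsg, mul_one]
            · exact hx1
            · simpa using hx
            · intro h; apply hx2; rw [h]; ring
          _ = _ := by simp
      rw [← hc]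
      calc _ = b * (A 1 * s * A (-2)) * (sg A s (x-1)) * (A 2 * s * A (-1)) := by
            simp only [mul_assoc]
        _ = (A 1 * s * A (-2)) * (b * sg A s (x-1)) * (A 2 * s * A (-1)) := by
            rw [← hz']; simp only [mul_assoc]
        _ = (A 1 * s * A (-2)) * sg A s (x-1) * (b * (A 2 * s * A (-1))) := by
            rw [ih]; simp only [mul_assoc]
        _ = _ := by rw [← hz]; simp only [mul_assoc]
  intro k h1 h2
  have := key (k+1) (by rwa [Ne, add_eq_zero_iff_eq_neg])
    (by intro h; apply h2; rw [← sub_eq_iff_eq_add.mpr h.symm]; ring)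
  simpa using this

theorem sge (R : Rels m A s b d c) (k x) (h1 : x ≠ k) (h2 : x ≠ k + 1) :
    sg A s k * ee A b x = ee A b x * sg A s k := by
  have := R.bsg (k - x - 1) (by intro h; apply h1; rw [sub_eq_iff_eq_add] at h; simp at h; rw [sub_eq_zero] at h; exact h.symm)
    (by intro h; apply h2; linear_combination -h)
  rw [← R.em1] at this
  apply R.Acancel (x+1)
  calc _ = sg A s (k-x-1) * ee A b (-1) * A (x+1) := by
        rw [← mul_assoc, R.Asg, mul_assoc, R.Ae, ← mul_assoc]; congr 3 <;> ring
    _ = ee A b (-1) * sg A s (k-x-1) * A (x+1) := by rw [← this]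
    _ = _ := by rw [← mul_assoc, R.Ae, mul_assoc, mul_assoc, R.Asg]; congr 3 <;> ring

theorem sgex (R : Rels m A s b d c) (k) : sg A s k * ee A b k = ee A b (k+1) * sg A s k := by
  apply R.Acancel k
  calc _ = s * ee A b 0 * A k := by
        rw [← mul_assoc, R.Asg, mul_assoc, R.Ae, ← mul_assoc]; simp [R.sg0]
    _ = ee A b 1 * sg A s 0 * A k := by rw [R.se0, R.sg0]
    _ = _ := by rw [← mul_assoc, R.Ae, mul_assoc, mul_assoc, R.Asg]; simp

theorem sgex1 (R : Rels m A s b d c) (k) : sg A s k * ee A b (k+1) = ee A b k * sg A s k := by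
  have : sg A s k * (sg A s k * ee A b k) * sg A s k
    = sg A s k * (ee A b (k+1) * sg A s k) * sg A s k := by rw [R.sgex]
  simp only [mul_assoc, R.sgsg, mul_one, R.sgsgw] at this
  exact this.symm

theorem e01 (R : Rels m A s b d c) : ee A b 0 * ee A b 1 = ee A b 1 * ee A b 0 := by
  have h := R.r2
  have h1 : ee A b 1 = s * ee A b 0 * s := by rw [R.se0, mul_assoc, R.ss, mul_one]
  rw [h1, R.e0]
  simp only [pow_two, mul_assoc] at h ⊢
  exact h

theorem e01s (R : Rels m A s b d c) : ee A b 0 * ee A b 1 * s = ee A b 0 * ee A b 1 := by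
  have h := R.r3
  rw [mul_assoc, ← R.se0, R.e01]
  have h1 : ee A b 1 = s * ee A b 0 * s := by rw [R.se0, mul_assoc, R.ss, mul_one]
  rw [h1, R.e0]
  simp only [pow_two, mul_assoc] at h ⊢
  exact h

theorem eesg (R : Rels m A s b d c) (k) :
    ee A b k * ee A b (k+1) * sg A s k = ee A b k * ee A b (k+1) := by
  apply R.Acancel k
  calc _ = ee A b 0 * ee A b 1 * s * A k := by
        simp only [mul_assoc]
        rw [← mul_assoc, R.Ae, mul_assoc, ← mul_assoc (A k), R.Ae, mul_assoc, R.Asg]; simp [R.sg0]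
    _ = _ := by
        rw [R.e01s, ← mul_assoc, R.Ae, mul_assoc, mul_assoc, R.Ae]; simp

theorem ecomm (R : Rels m A s b d c) (x y) : ee A b x * ee A b y = ee A b y * ee A b x := by
  have key : ∀ x : ZMod (m+3), x ≠ 0 → ee A b 0 * ee A b x = ee A b x * ee A b 0 := by
    apply cyc_ind
    · exact R.e01
    · intro x h0 h1 ih
      have h2 : ee A b (x+1) = sg A s x * ee A b x * sg A s x := by
        rw [R.sgex, mul_assoc, R.sgsg, mul_one]
      have h3 := R.sge x 0 (Ne.symm h0) (by intro h; apply h1; linear_combination -h)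
      calc _ = (ee A b 0 * sg A s x) * ee A b x * sg A s x := by rw [h2]; simp only [mul_assoc]
        _ = sg A s x * (ee A b 0 * ee A b x) * sg A s x := by rw [← h3]; simp only [mul_assoc]
        _ = sg A s x * ee A b x * (ee A b 0 * sg A s x) := by rw [ih]; simp only [mul_assoc]
        _ = _ := by rw [← h3, h2]; simp only [mul_assoc]
  by_cases h : y = x
  · rw [h]
  have := key (y-x) (by rwa [sub_ne_zero])
  apply R.Acancel x
  rw [← mul_assoc, R.Ae, mul_assoc, R.Ae, ← mul_assoc, ← mul_assoc, R.Ae, mul_assoc _ (A x), R.Ae,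
    ← mul_assoc, sub_self, this]

/-! the idempotent `c^2` -/

end Rels

/-- product of the idempotents killing `-1, -2, ..., -1-k` -/
def pp {m : ℕ} {M : Type*} [Monoid M] (A : ZMod (m+3) → M) (b : M) : ℕ → M
  | 0 => ee A b (-1)
  | k+1 => pp A b k * ee A b (-1 - ((k+1 : ℕ) : ZMod (m+3)))

namespace Rels

variable {m : ℕ} {M : Type*} [Monoid M] {A : ZMod (m+3) → M} {s b d c : M}

theorem ppform (R : Rels m A s b d c) (k : ℕ) :
    (b * A 1)^k * b = pp A b k * A (k : ZMod (m+3)) := by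
  induction k with
  | zero => simp [pp, R.em1, R.A0]
  | succ k ih =>
    calc _ = ((b * A 1)^k * b) * A 1 * b := by rw [pow_succ]; simp only [mul_assoc]
      _ = pp A b k * (A ((k+1 : ℕ) : ZMod (m+3)) * ee A b (-1)) := by
        rw [ih, R.em1, Nat.cast_succ, R.Aadd]; simp only [mul_assoc]
      _ = _ := by rw [R.Ae, pp, mul_assoc]

theorem ppcomm (R : Rels m A s b d c) (k : ℕ) (x) : pp A b k * ee A b x = ee A b x * pp A b k := by
  induction k with
  | zero => exact R.ecomm _ _
  | succ k ih => rw [pp, mul_assoc, R.ecomm, ← mul_assoc, ih, mul_assoc]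

theorem ppabs (R : Rels m A s b d c) (k i : ℕ) (h : i ≤ k) :
    pp A b k * ee A b (-1 - (i : ZMod (m+3))) = pp A b k := by
  induction k with
  | zero =>
    obtain rfl : i = 0 := by omega
    simp [pp, R.eidem]
  | succ k ih =>
    rcases Nat.lt_or_ge k i with h' | h'
    · obtain rfl : i = k + 1 := by omega
      rw [pp, mul_assoc, R.eidem]
    · rw [pp, mul_assoc, R.ecomm, ← mul_assoc, ih h']

theorem ppw (R : Rels m A s b d c) (w : M) (k : ℕ)
    (h : ∀ i : ℕ, i ≤ k → ee A b (-1 - (i : ZMod (m+3))) * w = w) : pp A b k * w = w := by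
  induction k with
  | zero => simpa [pp] using h 0 le_rfl
  | succ k ih => rw [pp, mul_assoc, h (k+1) le_rfl, ih (fun i hi => h i (by omega))]

theorem cA1s (R : Rels m A s b d c) : c * A 1 = c * s := R.cA

theorem cast_facts (m : ℕ) : ((m + 1 : ℕ) : ZMod (m+3)) = -2 := by
  have h : ((m + 3 : ℕ) : ZMod (m+3)) = 0 := ZMod.natCast_self _
  push_cast at h ⊢
  linear_combination h

theorem exists_cast (m : ℕ) (x : ZMod (m+3)) (hx : x ≠ 0) :
    ∃ i : ℕ, i ≤ m + 1 ∧ x = -1 - (i : ZMod (m+3)) := by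
  refine ⟨(-1 - x).val, ?_, ?_⟩
  · have h1 := ZMod.val_lt (-1 - x)
    by_contra h
    have h2 : (-1 - x).val = m + 2 := by omega
    have h3 := ZMod.natCast_zmod_val (-1 - x)
    rw [h2] at h3
    have h := cast_facts m
    push_cast at h h3
    apply hx
    linear_combination h3 - h
  · rw [ZMod.natCast_zmod_val]; ring

theorem cc (R : Rels m A s b d c) : c * c = pp A b (m+1) := by
  have h := R.E
  rw [R.ppform, cast_facts] at h
  apply R.Acancelr (-2)
  rw [h, pow_two]
  simp only [mul_assoc]
  rw [← mul_assoc c s, ← R.cA, mul_assoc, ← R.Aadd]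
  congr 4; ring

theorem ccc' (R : Rels m A s b d c) : c * c * c = c := by
  have := R.ccc
  rwa [pow_succ, pow_two] at this

theorem ccc'' (R : Rels m A s b d c) : c * (c * c) = c := by
  rw [← mul_assoc]; exact R.ccc'

theorem cce (R : Rels m A s b d c) (x) (hx : x ≠ 0) : c * c * ee A b x = c * c := by
  obtain ⟨i, hi, rfl⟩ := exists_cast m x hx
  rw [R.cc, R.ppabs _ _ hi]

theorem ccecomm (R : Rels m A s b d c) (x) : c * c * ee A b x = ee A b x * (c * c) := by
  rw [R.cc, R.ppcomm]

theorem ce (R : Rels m A s b d c) (x) (hx : x ≠ 0) : c * ee A b x = c := by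
  rw [← R.ccc'', mul_assoc, R.cce x hx]

theorem ec (R : Rels m A s b d c) (x) (hx : x ≠ 0) : ee A b x * c = c := by
  have h := R.ccc'
  rw [← h, ← mul_assoc, ← R.ccecomm, R.cce x hx]

theorem ccw (R : Rels m A s b d c) (w : M) (h : ∀ x, x ≠ 0 → ee A b x * w = w) :
    c * c * w = w := by
  rw [R.cc]
  apply R.ppw
  intro i hi
  apply h
  intro h0
  have h3 : ((i + 1 : ℕ) : ZMod (m+3)) = 0 := by push_cast; linear_combination -h0
  rw [ZMod.natCast_eq_zero_iff] at h3
  have := Nat.le_of_dvd (by omega) h3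
  omega

theorem csg (R : Rels m A s b d c) (x) (h0 : x ≠ 0) (h1 : x ≠ -1) : c * sg A s x = c := by
  have h1 : x + 1 ≠ 0 := by rwa [Ne, add_eq_zero_iff_eq_neg]
  have h : c = c * (ee A b x * ee A b (x+1)) := by rw [← mul_assoc, R.ce _ h0, R.ce _ h1]
  rw [h, mul_assoc, R.eesg, ← h]

theorem cAs (R : Rels m A s b d c) (j) (h0 : j ≠ 0) (h1 : j ≠ 1) : c * A j * s = c * A j := by
  have := R.csg (-j) (by simpa using h0) (by simpa using h1)
  calc _ = c * sg A s (-j) * A j := by simp [sg, mul_assoc, R.AnA]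
    _ = _ := by rw [this]

theorem dA (R : Rels m A s b d c) (j) : d * A j = A j * d := by
  have key : ∀ k : ℕ, d * A (k : ZMod (m+3)) = A (k : ZMod (m+3)) * d := by
    intro k
    induction k with
    | zero => simp [R.A0]
    | succ k ih => rw [Nat.cast_succ, R.Aadd, ← mul_assoc, ih, mul_assoc, R.dA1, mul_assoc]
  rw [← ZMod.natCast_zmod_val j]
  exact key _

theorem de (R : Rels m A s b d c) (x) : d * ee A b x = ee A b x * d := by
  rw [ee, ← mul_assoc, ← mul_assoc, R.dA, mul_assoc _ d, R.db, ← mul_assoc, mul_assoc _ d, R.dA,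
    ← mul_assoc]

theorem dpp (R : Rels m A s b d c) (k) : d * pp A b k = pp A b k * d := by
  induction k with
  | zero => exact R.de _
  | succ k ih => rw [pp, ← mul_assoc, ih, mul_assoc, R.de, mul_assoc]

theorem dcc' (R : Rels m A s b d c) : d * (c * c) = c * c * d := by
  rw [R.cc, R.dpp]

theorem scd (R : Rels m A s b d c) : s * c * d = c * d := by
  rw [mul_assoc, ← R.bA1c, ← mul_assoc, ← mul_assoc, R.sb, mul_assoc, mul_assoc, ← mul_assoc s,
    R.sAc 1 (one_ne0 m) (one_ne_neg m), ← mul_assoc]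

theorem Am1cd (R : Rels m A s b d c) : A (-1) * c * d = c * d := by
  rw [R.Ac, R.scd]

theorem A1cd (R : Rels m A s b d c) : A 1 * c * d = c * d := by
  apply R.Acancel (-1)
  rw [mul_assoc, ← mul_assoc _ (A 1), R.AnA, one_mul, ← mul_assoc, R.Am1cd]

theorem Acd (R : Rels m A s b d c) (j) : A j * c * d = c * d := by
  have key : ∀ k : ℕ, A (k : ZMod (m+3)) * c * d = c * d := by
    intro k
    induction k with
    | zero => simp [R.A0]
    | succ k ih =>
      rw [Nat.cast_succ, R.Aadd, mul_assoc, mul_assoc, ← mul_assoc _ c, R.A1cd, ← mul_assoc, ih]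
  rw [← ZMod.natCast_zmod_val j]
  exact key _

theorem e0c (R : Rels m A s b d c) : ee A b 0 * c = c * d := by
  rw [R.e0, mul_assoc, mul_assoc, ← mul_assoc b, R.bA1c, ← mul_assoc, R.Am1cd]

theorem ce0 (R : Rels m A s b d c) : c * ee A b 0 = d * c := by
  calc _ = c * (c * c * ee A b 0) := by rw [← mul_assoc, R.ccc'']
    _ = c * (ee A b 0 * c) * c := by rw [R.ccecomm]; simp only [mul_assoc]
    _ = (c * c * d) * c := by rw [R.e0c]; simp only [mul_assoc]
    _ = d * (c * c * c) := by rw [← R.dcc']; simp only [mul_assoc]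
    _ = _ := by rw [R.ccc']

theorem dce (R : Rels m A s b d c) (x) : d * c * ee A b x = d * c := by
  by_cases h : x = 0
  · rw [h, mul_assoc, R.ce0, ← mul_assoc, R.dd]
  · rw [mul_assoc, R.ce x h]

theorem dcs (R : Rels m A s b d c) : d * c * s = d * c := by
  have h : d * c = d * c * (ee A b 0 * ee A b 1) := by rw [← mul_assoc, R.dce, R.dce]
  rw [h, mul_assoc, R.e01s]

theorem dcA (R : Rels m A s b d c) (j) : d * c * A j = d * c := by
  have key : ∀ k : ℕ, d * c * A (k : ZMod (m+3)) = d * c := by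
    intro k
    induction k with
    | zero => simp [R.A0]
    | succ k ih =>
      rw [Nat.cast_succ, R.Aadd, ← mul_assoc, ih, mul_assoc, R.cA, ← mul_assoc, R.dcs]
  rw [← ZMod.natCast_zmod_val j]
  exact key _

theorem cAc (R : Rels m A s b d c) : ∀ j, j ≠ 0 → c * A j * c = d * c * c := by
  apply cyc_ind
  · rw [R.cA, ← R.dcc, pow_two, mul_assoc]
  · intro x h0 h1 ih
    rw [← ih, add_comm, R.Aadd, ← mul_assoc, R.cA, mul_assoc, mul_assoc, ← mul_assoc s,
      R.sAc x h0 h1, ← mul_assoc]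

theorem zc (R : Rels m A s b d c) : d * c * d * c = d * c * d := by
  rw [mul_assoc (d * c)]; exact (pow_two _).symm.trans R.dcd

theorem cz (R : Rels m A s b d c) : c * (d * c * d) = d * c * d := by
  calc _ = c * d * (c * d) := by simp only [mul_assoc]
    _ = c * (d * ee A b 0) * c := by nth_rewrite 2 [← R.e0c]; simp only [mul_assoc]
    _ = (c * ee A b 0) * d * c := by rw [R.de]; simp only [mul_assoc]
    _ = _ := by rw [R.ce0, R.zc]

theorem zA (R : Rels m A s b d c) (j) : d * c * d * A j = d * c * d := by
  rw [mul_assoc, R.dA, ← mul_assoc, R.dcA]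

theorem Az (R : Rels m A s b d c) (j) : A j * (d * c * d) = d * c * d := by
  rw [mul_assoc, ← mul_assoc, ← R.dA, mul_assoc, ← mul_assoc (A j), R.Acd, ← mul_assoc]

/-- `c A^j d c` for `j ≠ 0` is zero. -/
theorem cAdc (R : Rels m A s b d c) (j) (h : j ≠ 0) : c * A j * d * c = d * c * d := by
  calc _ = c * (d * A j) * c := by rw [R.dA]; simp only [mul_assoc]
    _ = ee A b 0 * (c * A j * c) := by rw [← mul_assoc, ← R.e0c]; simp only [mul_assoc]
    _ = (d * ee A b 0) * c * c := by rw [R.cAc j h, R.de]; simp only [mul_assoc]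
    _ = d * (c * d) * c := by rw [← R.e0c]; simp only [mul_assoc]
    _ = _ := by rw [← R.zc]; simp only [mul_assoc]

theorem sA_c (R : Rels m A s b d c) (i : ZMod (m+3)) :
    s * A (-i) * c = A (-(Equiv.swap 0 1 i)) * c := by
  by_cases h0 : i = 0
  · subst h0; simp [R.A0, R.Ac]
  by_cases h1 : i = 1
  · subst h1; simp [R.A0, mul_assoc, R.Ac, R.ssw]
  rw [Equiv.swap_apply_of_ne_of_ne h0 h1]
  exact R.sAc _ (by simpa using h0) (by simpa using h1)

theorem cA_s (R : Rels m A s b d c) (j : ZMod (m+3)) :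
    c * A j * s = c * A (Equiv.swap 0 1 j) := by
  by_cases h0 : j = 0
  · subst h0; simp [R.A0, R.cA]
  by_cases h1 : j = 1
  · subst h1
    rw [Equiv.swap_apply_right, R.A0, R.cA, mul_assoc, R.ss]
  rw [Equiv.swap_apply_of_ne_of_ne h0 h1]
  exact R.cAs _ h0 h1

theorem bA_c (R : Rels m A s b d c) (i : ZMod (m+3)) (h : i ≠ -1) :
    b * A (-i) * c = A (-i) * c := by
  have : b * A (-i) = A (-i) * ee A b (-1 -i) := by rw [R.Ae, ← R.em1]; simp [R.em1]
  rw [this, mul_assoc, R.ec]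
  intro h0; apply h; linear_combination -h0

theorem cA_b (R : Rels m A s b d c) (j : ZMod (m+3)) (h : j ≠ -1) :
    c * A j * b = c * A j := by
  rw [mul_assoc, ← R.em1, R.Ae, ← mul_assoc, R.ce]
  intro h0; apply h; linear_combination -h0

theorem cA_b' (R : Rels m A s b d c) : c * A (-1) * b = d * c := by
  have := R.Ae (-1) (-1)
  rw [R.em1] at this
  rw [mul_assoc, this, ← mul_assoc]
  simp only [sub_self]
  rw [R.ce0, R.dcA]

end Rels

/-! ### Semantics: vertices are `none` (centre) and `some x`, `x : ZMod (n-1)` (leaves) -/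

/-- action of a letter on the vertices -/
def gs (m : ℕ) : Gen → Option (ZMod (m+3)) → Option (Option (ZMod (m+3)))
  | Gen.a1, none => some none
  | Gen.a1, some x => some (some (x+1))
  | Gen.a2, none => some none
  | Gen.a2, some x => some (some (Equiv.swap 0 1 x))
  | Gen.b1, none => some none
  | Gen.b1, some x => if x = -1 then none else some (some x)
  | Gen.b2, none => none
  | Gen.b2, some x => some (some x)
  | Gen.c, none => some (some 0)
  | Gen.c, some x => if x = 0 then some none else none

/-- action of a word -/
def ev (m : ℕ) : List Gen → Option (ZMod (m+3)) → Option (Option (ZMod (m+3)))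
  | [], p => some p
  | g :: l, p => (gs m g p).bind (ev m l)

theorem ev_append (m : ℕ) (l l' : List Gen) (p) :
    ev m (l ++ l') p = (ev m l p).bind (ev m l') := by
  induction l generalizing p with
  | nil => rfl
  | cons g l ih =>
    simp only [List.cons_append, ev, Option.bind_assoc]
    congr 1; funext x; exact ih x

/-- value of a letter -/
def qv {m : ℕ} {M : Type*} (A : ZMod (m+3) → M) (s b d c : M) : Gen → M
  | Gen.a1 => A 1
  | Gen.a2 => s
  | Gen.b1 => b
  | Gen.b2 => d
  | Gen.c => c

/-- value of a word -/
def qw {m : ℕ} {M : Type*} [Monoid M] (A : ZMod (m+3) → M) (s b d c : M) (l : List Gen) : M :=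
  (l.map (qv A s b d c)).prod

/-- normal forms -/
inductive NF (m : ℕ) : Type
  | f1 (i j : ZMod (m+3))
  | f2 (i j : ZMod (m+3))
  | f3 (i : ZMod (m+3))
  | f4 (j : ZMod (m+3))
  | f5 (i j : ZMod (m+3))
  | f6
  | f7

def NF.val {m : ℕ} {M : Type*} [Monoid M] (A : ZMod (m+3) → M) (d c : M) : NF m → M
  | f1 i j => A (-i) * c * A j
  | f2 i j => A (-i) * c * c * A j
  | f3 i => A (-i) * d * c
  | f4 j => c * d * A j
  | f5 i j => A (-i) * d * c * c * A j
  | f6 => c * d * c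
  | f7 => d * c * d

def NF.sem {m : ℕ} : NF m → Option (ZMod (m+3)) → Option (Option (ZMod (m+3)))
  | f1 _ j, none => some (some j)
  | f1 i _, some x => if x = i then some none else none
  | f2 _ _, none => some none
  | f2 i j, some x => if x = i then some (some j) else none
  | f3 _, none => none
  | f3 i, some x => if x = i then some none else none
  | f4 j, none => some (some j)
  | f4 _, some _ => none
  | f5 _ _, none => none
  | f5 i j, some x => if x = i then some (some j) else none
  | f6, none => some none
  | f6, some _ => none
  | f7, _ => none

/-- the leaf in the domain -/
def NF.leaf {m : ℕ} : NF m → ZMod (m+3)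
  | f1 i _ => i
  | f2 i _ => i
  | f3 i => i
  | f4 _ => 0
  | f5 i _ => i
  | f6 => 0
  | f7 => 0

theorem NF.sem_leaf {m : ℕ} (f : NF m) (x : ZMod (m+3)) (hx : x ≠ f.leaf) :
    f.sem (some x) = none := by
  cases f <;> simp_all [NF.sem, NF.leaf]

theorem NF.sem_inj {m : ℕ} (f g : NF m) (h : f.sem = g.sem) : f = g := by
  have h0 := congrFun h none
  have h1 := congrFun h (some f.leaf)
  have h2 := congrFun h (some g.leaf)
  cases f <;> cases g <;> simp [NF.sem, NF.leaf] at h0 h1 h2 ⊢ <;> grind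

namespace Rels

variable {m : ℕ} {M : Type*} [Monoid M] {A : ZMod (m+3) → M} {s b d c : M}

theorem swap_eq {m : ℕ} (x i : ZMod (m+3)) : Equiv.swap 0 1 x = i ↔ x = Equiv.swap 0 1 i := by
  constructor
  · rintro rfl; simp
  · rintro rfl; simp

theorem dAc (R : Rels m A s b d c) (i) : d * (A i * c) = A i * d * c := by
  rw [← mul_assoc, R.dA]

theorem dccc (R : Rels m A s b d c) : d * c * c * c = d * c := by
  rw [mul_assoc, mul_assoc, ← mul_assoc c, R.ccc']

/-- left multiplication of a normal form by a letter -/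
theorem left_step (R : Rels m A s b d c) (g : Gen) (f : NF m) :
    ∃ f' : NF m, qv A s b d c g * f.val A d c = f'.val A d c ∧
      ∀ p, (gs m g p).bind f.sem = f'.sem p := by
  cases g with
  | a1 =>
    have hA : ∀ i : ZMod (m+3), A 1 * A (-i) = A (-(i-1)) := by
      intro i; rw [← R.Aadd]; congr 1; ring
    have hx : ∀ x i : ZMod (m+3), x + 1 = i ↔ x = i - 1 := by
      intro x i; exact eq_sub_iff_add_eq.symm
    cases f with
    | f1 i j => exact ⟨.f1 (i-1) j, by simp [NF.val, qv, ← mul_assoc, hA], by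
        rintro (_ | x) <;> simp [gs, NF.sem, hx]⟩
    | f2 i j => exact ⟨.f2 (i-1) j, by simp [NF.val, qv, ← mul_assoc, hA], by
        rintro (_ | x) <;> simp [gs, NF.sem, hx]⟩
    | f3 i => exact ⟨.f3 (i-1), by simp [NF.val, qv, ← mul_assoc, hA], by
        rintro (_ | x) <;> simp [gs, NF.sem, hx]⟩
    | f4 j => exact ⟨.f4 j, by simp only [NF.val, qv, ← mul_assoc, R.Acd], by
        rintro (_ | x) <;> simp [gs, NF.sem]⟩
    | f5 i j => exact ⟨.f5 (i-1) j, by simp [NF.val, qv, ← mul_assoc, hA], by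
        rintro (_ | x) <;> simp [gs, NF.sem, hx]⟩
    | f6 => exact ⟨.f6, by simp only [NF.val, qv, ← mul_assoc, R.Acd], by
        rintro (_ | x) <;> simp [gs, NF.sem]⟩
    | f7 => exact ⟨.f7, by simp only [NF.val, qv, R.Az], by
        rintro (_ | x) <;> simp [gs, NF.sem]⟩
  | a2 =>
    have hA : ∀ i : ZMod (m+3), s * A (-i) * d * c = A (-(Equiv.swap 0 1 i)) * d * c := by
      intro i
      rw [mul_assoc s, ← R.dA, ← mul_assoc, ← R.ds, mul_assoc, mul_assoc, ← mul_assoc s, R.sA_c,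
        R.dAc]
    cases f with
    | f1 i j => exact ⟨.f1 (Equiv.swap 0 1 i) j, by simp only [NF.val, qv, ← mul_assoc, R.sA_c], by
        rintro (_ | x) <;> simp [gs, NF.sem, swap_eq]⟩
    | f2 i j => exact ⟨.f2 (Equiv.swap 0 1 i) j, by simp only [NF.val, qv, ← mul_assoc, R.sA_c], by
        rintro (_ | x) <;> simp [gs, NF.sem, swap_eq]⟩
    | f3 i => exact ⟨.f3 (Equiv.swap 0 1 i), by simp only [NF.val, qv, ← mul_assoc, hA], by
        rintro (_ | x) <;> simp [gs, NF.sem, swap_eq]⟩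
    | f4 j => exact ⟨.f4 j, by simp only [NF.val, qv, ← mul_assoc, R.scd], by
        rintro (_ | x) <;> simp [gs, NF.sem]⟩
    | f5 i j => exact ⟨.f5 (Equiv.swap 0 1 i) j, by simp only [NF.val, qv, ← mul_assoc, hA], by
        rintro (_ | x) <;> simp [gs, NF.sem, swap_eq]⟩
    | f6 => exact ⟨.f6, by simp only [NF.val, qv, ← mul_assoc, R.scd], by
        rintro (_ | x) <;> simp [gs, NF.sem]⟩
    | f7 => exact ⟨.f7, by
        simp only [NF.val, qv, ← mul_assoc]
        rw [← R.ds, mul_assoc, mul_assoc, ← mul_assoc s, R.scd, ← mul_assoc], by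
        rintro (_ | x) <;> simp [gs, NF.sem]⟩
  | b1 =>
    have h1 : b * A (- -1) * c = c * d := by rw [neg_neg, R.bA1c]
    have hb : ∀ i : ZMod (m+3), b * A (-i) * d = d * b * A (-i) := by
      intro i; rw [mul_assoc, ← R.dA, ← mul_assoc, ← R.db]
    have hA : ∀ i : ZMod (m+3), i ≠ -1 → b * A (-i) * d * c = A (-i) * d * c := by
      intro i hi
      rw [hb, mul_assoc, mul_assoc, ← mul_assoc b, R.bA_c i hi, R.dAc]
    have hA1 : b * A (- -1) * d * c = d * c * d := by
      rw [hb, mul_assoc, mul_assoc, ← mul_assoc b, h1, mul_assoc]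
    have hbc : b * c = c := by
      have := R.bA_c 0 (by intro h; apply one_ne0 m; linear_combination h)
      simpa [R.A0] using this
    have hx : ∀ x i : ZMod (m+3), i ≠ -1 → (x = -1 → x ≠ i) := by
      rintro x i h rfl; exact Ne.symm h
    have hcdcA : ∀ j, c * d * c * A j = c * d * c := by
      intro j; rw [mul_assoc, mul_assoc, ← mul_assoc d, R.dcA, ← mul_assoc]
    cases f with
    | f1 i j =>
      by_cases hi : i = -1
      · subst hi
        exact ⟨.f4 j, by simp only [NF.val, qv, ← mul_assoc, h1], by
          rintro (_ | x)
          · simp [gs, NF.sem]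
          · by_cases hx : x = -1 <;> simp [gs, NF.sem, hx]⟩
      · exact ⟨.f1 i j, by simp only [NF.val, qv, ← mul_assoc, R.bA_c i hi], by
          rintro (_ | x)
          · simp [gs, NF.sem]
          · by_cases hx : x = -1 <;> simp [gs, NF.sem, hx, Ne.symm hi]⟩
    | f2 i j =>
      by_cases hi : i = -1
      · subst hi
        exact ⟨.f6, by simp only [NF.val, qv, ← mul_assoc, h1, hcdcA], by
          rintro (_ | x)
          · simp [gs, NF.sem]
          · by_cases hx : x = -1 <;> simp [gs, NF.sem, hx]⟩
      · exact ⟨.f2 i j, by simp only [NF.val, qv, ← mul_assoc, R.bA_c i hi], by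
          rintro (_ | x)
          · simp [gs, NF.sem]
          · by_cases hx : x = -1 <;> simp [gs, NF.sem, hx, Ne.symm hi]⟩
    | f3 i =>
      by_cases hi : i = -1
      · subst hi
        exact ⟨.f7, by simp only [NF.val, qv, ← mul_assoc, hA1], by
          rintro (_ | x)
          · simp [gs, NF.sem]
          · by_cases hx : x = -1 <;> simp [gs, NF.sem, hx]⟩
      · exact ⟨.f3 i, by simp only [NF.val, qv, ← mul_assoc, hA i hi], by
          rintro (_ | x)
          · simp [gs, NF.sem]
          · by_cases hx : x = -1 <;> simp [gs, NF.sem, hx, Ne.symm hi]⟩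
    | f4 j => exact ⟨.f4 j, by simp only [NF.val, qv, ← mul_assoc, hbc], by
          rintro (_ | x)
          · simp [gs, NF.sem]
          · by_cases hx : x = -1 <;> simp [gs, NF.sem, hx]⟩
    | f5 i j =>
      by_cases hi : i = -1
      · subst hi
        exact ⟨.f7, by simp only [NF.val, qv, ← mul_assoc, hA1, R.zc, R.zA], by
          rintro (_ | x)
          · simp [gs, NF.sem]
          · by_cases hx : x = -1 <;> simp [gs, NF.sem, hx]⟩
      · exact ⟨.f5 i j, by simp only [NF.val, qv, ← mul_assoc, hA i hi], by
          rintro (_ | x)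
          · simp [gs, NF.sem]
          · by_cases hx : x = -1 <;> simp [gs, NF.sem, hx, Ne.symm hi]⟩
    | f6 => exact ⟨.f6, by simp only [NF.val, qv, ← mul_assoc, hbc], by
          rintro (_ | x)
          · simp [gs, NF.sem]
          · by_cases hx : x = -1 <;> simp [gs, NF.sem, hx]⟩
    | f7 => exact ⟨.f7, by
          simp only [NF.val, qv, ← mul_assoc]
          rw [← R.db, mul_assoc d, hbc], by
          rintro (_ | x)
          · simp [gs, NF.sem]
          · by_cases hx : x = -1 <;> simp [gs, NF.sem, hx]⟩
  | b2 =>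
    have hdd : ∀ i, A i * d * d = A i * d := by intro i; rw [mul_assoc, R.dd]
    cases f with
    | f1 i j => exact ⟨.f3 i, by
        simp only [NF.val, qv, ← mul_assoc, R.dA]
        rw [mul_assoc, mul_assoc, ← mul_assoc d, R.dcA, ← mul_assoc], by
        rintro (_ | x) <;> simp [gs, NF.sem]⟩
    | f2 i j => exact ⟨.f5 i j, by simp only [NF.val, qv, ← mul_assoc, R.dA], by
        rintro (_ | x) <;> simp [gs, NF.sem]⟩
    | f3 i => exact ⟨.f3 i, by simp only [NF.val, qv, ← mul_assoc, R.dA, hdd], by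
        rintro (_ | x) <;> simp [gs, NF.sem]⟩
    | f4 j => exact ⟨.f7, by simp only [NF.val, qv, ← mul_assoc, R.zA], by
        rintro (_ | x) <;> simp [gs, NF.sem]⟩
    | f5 i j => exact ⟨.f5 i j, by simp only [NF.val, qv, ← mul_assoc, R.dA, hdd], by
        rintro (_ | x) <;> simp [gs, NF.sem]⟩
    | f6 => exact ⟨.f7, by simp only [NF.val, qv, ← mul_assoc, R.zc], by
        rintro (_ | x) <;> simp [gs, NF.sem]⟩
    | f7 => exact ⟨.f7, by simp only [NF.val, qv, ← mul_assoc, R.dd], by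
        rintro (_ | x) <;> simp [gs, NF.sem]⟩
  | c =>
    have hcd : c * c * d = d * c * c := by rw [← R.dcc', mul_assoc]
    have hcdc : c * d * c * c = c * d := by
      rw [mul_assoc, mul_assoc, ← mul_assoc d, mul_assoc d, R.dcc', ← mul_assoc, R.ccc'']
    cases f with
    | f1 i j =>
      by_cases hi : i = 0
      · subst hi
        exact ⟨.f2 0 j, by simp [NF.val, qv, ← mul_assoc, R.A0], by
          rintro (_ | x)
          · simp [gs, NF.sem]
          · by_cases hx : x = 0 <;> simp [gs, NF.sem, hx]⟩
      · exact ⟨.f5 0 j, by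
          simp only [NF.val, qv, ← mul_assoc, R.cAc (-i) (by simpa using hi), neg_zero, R.A0,
            one_mul], by
          rintro (_ | x)
          · simp [gs, NF.sem, Ne.symm hi]
          · by_cases hx : x = 0 <;> simp [gs, NF.sem, hx]⟩
    | f2 i j =>
      by_cases hi : i = 0
      · subst hi
        exact ⟨.f1 0 j, by simp [NF.val, qv, ← mul_assoc, R.A0, R.ccc'], by
          rintro (_ | x)
          · simp [gs, NF.sem]
          · by_cases hx : x = 0 <;> simp [gs, NF.sem, hx]⟩
      · exact ⟨.f3 0, by
          simp only [NF.val, qv, ← mul_assoc, R.cAc (-i) (by simpa using hi), neg_zero, R.A0,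
            one_mul, R.dccc, R.dcA], by
          rintro (_ | x)
          · simp [gs, NF.sem, Ne.symm hi]
          · by_cases hx : x = 0 <;> simp [gs, NF.sem, hx]⟩
    | f3 i =>
      by_cases hi : i = 0
      · subst hi
        exact ⟨.f6, by simp [NF.val, qv, ← mul_assoc, R.A0], by
          rintro (_ | x)
          · simp [gs, NF.sem]
          · by_cases hx : x = 0 <;> simp [gs, NF.sem, hx]⟩
      · exact ⟨.f7, by
          simp only [NF.val, qv, ← mul_assoc, R.cAdc (-i) (by simpa using hi)], by
          rintro (_ | x)
          · simp [gs, NF.sem, Ne.symm hi]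
          · by_cases hx : x = 0 <;> simp [gs, NF.sem, hx]⟩
    | f4 j => exact ⟨.f5 0 j, by
          simp only [NF.val, qv, ← mul_assoc, hcd, neg_zero, R.A0, one_mul], by
          rintro (_ | x)
          · simp [gs, NF.sem]
          · by_cases hx : x = 0 <;> simp [gs, NF.sem, hx]⟩
    | f5 i j =>
      by_cases hi : i = 0
      · subst hi
        exact ⟨.f4 j, by simp only [NF.val, qv, ← mul_assoc, neg_zero, R.A0, mul_one, hcdc], by
          rintro (_ | x)
          · simp [gs, NF.sem]
          · by_cases hx : x = 0 <;> simp [gs, NF.sem, hx]⟩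
      · exact ⟨.f7, by
          simp only [NF.val, qv, ← mul_assoc, R.cAdc (-i) (by simpa using hi), R.zc, R.zA], by
          rintro (_ | x)
          · simp [gs, NF.sem, Ne.symm hi]
          · by_cases hx : x = 0 <;> simp [gs, NF.sem, hx]⟩
    | f6 => exact ⟨.f3 0, by
          simp only [NF.val, qv, ← mul_assoc, hcd, neg_zero, R.A0, one_mul, R.dccc], by
          rintro (_ | x)
          · simp [gs, NF.sem]
          · by_cases hx : x = 0 <;> simp [gs, NF.sem, hx]⟩
    | f7 => exact ⟨.f7, by simp only [NF.val, qv, R.cz], by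
          rintro (_ | x)
          · simp [gs, NF.sem]
          · by_cases hx : x = 0 <;> simp [gs, NF.sem, hx]⟩

/-- forms of the words `c t` with `t` free of `c` -/
def tf (f : NF m) : Prop :=
  (∃ j, f = .f1 0 j) ∨ (∃ j, f = .f4 j) ∨ f = .f3 0 ∨ f = .f7

theorem right_step (R : Rels m A s b d c) (g : Gen) (hg : g ≠ Gen.c) (f : NF m) (hf : tf f) :
    ∃ f' : NF m, tf f' ∧ f.val A d c * qv A s b d c g = f'.val A d c ∧
      ∀ p, (f.sem p).bind (gs m g) = f'.sem p := by
  have tf1 : ∀ j : ZMod (m+3), tf (.f1 0 j) := fun j => Or.inl ⟨j, rfl⟩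
  have tf4 : ∀ j : ZMod (m+3), tf (.f4 j) := fun j => Or.inr (Or.inl ⟨j, rfl⟩)
  have tf3 : tf (.f3 0 : NF m) := Or.inr (Or.inr (Or.inl rfl))
  have tf7 : tf (.f7 : NF m) := Or.inr (Or.inr (Or.inr rfl))
  have hsem : ∀ x : ZMod (m+3), x = 0 ∨ x ≠ 0 := fun x => eq_or_ne x 0
  have hdA : ∀ j, c * d * A j = c * A j * d := by intro j; rw [mul_assoc, R.dA, ← mul_assoc]
  have hcb : c * b = c := by
    have := R.cA_b 0 (by intro h; apply one_ne0 m; linear_combination h)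
    simpa [R.A0] using this
  rcases hf with ⟨j, rfl⟩ | ⟨j, rfl⟩ | rfl | rfl
  · -- c A^j
    cases g with
    | a1 => exact ⟨.f1 0 (j+1), tf1 _, by simp [NF.val, qv, R.Aadd, mul_assoc], by
        rintro (_ | x)
        · simp [gs, NF.sem]
        · rcases hsem x with rfl | hx <;> simp [gs, NF.sem, *]⟩
    | a2 => exact ⟨.f1 0 (Equiv.swap 0 1 j), tf1 _, by
        simp only [NF.val, qv, neg_zero, R.A0, one_mul, R.cA_s], by
        rintro (_ | x)
        · simp [gs, NF.sem]
        · rcases hsem x with rfl | hx <;> simp [gs, NF.sem, *]⟩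
    | b1 =>
      by_cases hj : j = -1
      · subst hj
        exact ⟨.f3 0, tf3, by simp only [NF.val, qv, neg_zero, R.A0, one_mul, R.cA_b'], by
          rintro (_ | x)
          · simp [gs, NF.sem]
          · rcases hsem x with rfl | hx <;> simp [gs, NF.sem, *]⟩
      · exact ⟨.f1 0 j, tf1 _, by simp only [NF.val, qv, neg_zero, R.A0, one_mul, R.cA_b j hj], by
          rintro (_ | x)
          · simp [gs, NF.sem, hj]
          · rcases hsem x with rfl | hx <;> simp [gs, NF.sem, *]⟩
    | b2 => exact ⟨.f4 j, tf4 _, by simp only [NF.val, qv, neg_zero, R.A0, one_mul, hdA], by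
        rintro (_ | x)
        · simp [gs, NF.sem]
        · rcases hsem x with rfl | hx <;> simp [gs, NF.sem, *]⟩
    | c => exact absurd rfl hg
  · cases g with
    | a1 => exact ⟨.f4 (j+1), tf4 _, by simp [NF.val, qv, R.Aadd, mul_assoc], by
        rintro (_ | x) <;> simp [gs, NF.sem]⟩
    | a2 => exact ⟨.f4 (Equiv.swap 0 1 j), tf4 _, by
        simp only [NF.val, qv, hdA, ← R.cA_s]
        rw [mul_assoc, R.ds, ← mul_assoc], by
        rintro (_ | x) <;> simp [gs, NF.sem]⟩
    | b1 =>
      by_cases hj : j = -1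
      · subst hj
        exact ⟨.f7, tf7, by
          simp only [NF.val, qv, hdA]
          rw [mul_assoc, R.db, ← mul_assoc, R.cA_b'], by
          rintro (_ | x) <;> simp [gs, NF.sem]⟩
      · exact ⟨.f4 j, tf4 _, by
          simp only [NF.val, qv, hdA]
          rw [mul_assoc, R.db, ← mul_assoc, R.cA_b j hj], by
          rintro (_ | x) <;> simp [gs, NF.sem, hj]⟩
    | b2 => exact ⟨.f4 j, tf4 _, by
        simp only [NF.val, qv, hdA]
        rw [mul_assoc, R.dd], by
        rintro (_ | x) <;> simp [gs, NF.sem]⟩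
    | c => exact absurd rfl hg
  · cases g with
    | a1 => exact ⟨.f3 0, tf3, by simp only [NF.val, qv, neg_zero, R.A0, one_mul, R.dcA], by
        rintro (_ | x)
        · simp [gs, NF.sem]
        · rcases hsem x with rfl | hx <;> simp [gs, NF.sem, *]⟩
    | a2 => exact ⟨.f3 0, tf3, by simp only [NF.val, qv, neg_zero, R.A0, one_mul, R.dcs], by
        rintro (_ | x)
        · simp [gs, NF.sem]
        · rcases hsem x with rfl | hx <;> simp [gs, NF.sem, *]⟩
    | b1 => exact ⟨.f3 0, tf3, by
        simp only [NF.val, qv, neg_zero, R.A0, one_mul, mul_assoc, hcb], by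
        rintro (_ | x)
        · simp [gs, NF.sem]
        · rcases hsem x with rfl | hx <;> simp [gs, NF.sem, *]⟩
    | b2 => exact ⟨.f7, tf7, by simp only [NF.val, qv, neg_zero, R.A0, one_mul], by
        rintro (_ | x)
        · simp [gs, NF.sem]
        · rcases hsem x with rfl | hx <;> simp [gs, NF.sem, *]⟩
    | c => exact absurd rfl hg
  · refine ⟨.f7, tf7, ?_, by intro p; simp [NF.sem]⟩
    cases g with
    | a1 => simp only [NF.val, qv, R.zA]
    | a2 => simp only [NF.val, qv]; rw [mul_assoc, R.ds, ← mul_assoc, R.dcs]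
    | b1 => simp only [NF.val, qv]; rw [mul_assoc, R.db, ← mul_assoc, mul_assoc d, hcb]
    | b2 => simp only [NF.val, qv]; rw [mul_assoc, R.dd]
    | c => exact absurd rfl hg

theorem right_nf (R : Rels m A s b d c) (l : List Gen) (hl : Gen.c ∉ l) :
    ∃ f : NF m, tf f ∧ c * qw A s b d c l = f.val A d c ∧
      ∀ p, (gs m Gen.c p).bind (ev m l) = f.sem p := by
  induction l using List.reverseRecOn with
  | nil =>
    refine ⟨.f1 0 0, Or.inl ⟨0, rfl⟩, by simp [qw, NF.val, R.A0], ?_⟩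
    rintro (_ | x)
    · simp [gs, NF.sem, ev]
    · by_cases hx : x = 0 <;> simp [gs, NF.sem, ev, hx]
  | append_singleton l g ih =>
    obtain ⟨f, hf, h1, h2⟩ := ih (by simp at hl; tauto)
    obtain ⟨f', hf', h1', h2'⟩ := R.right_step g (by simp at hl; tauto) f hf
    refine ⟨f', hf', ?_, ?_⟩
    · rw [← h1', ← h1]; simp [qw, mul_assoc]
    · intro p
      rw [← h2', ← h2, Option.bind_assoc]
      congr 1; funext x
      rw [ev_append]; congr 1; funext y; simp [ev]

theorem word_nf (R : Rels m A s b d c) (l : List Gen) (hl : Gen.c ∈ l) :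
    ∃ f : NF m, qw A s b d c l = f.val A d c ∧ ∀ p, ev m l p = f.sem p := by
  induction l with
  | nil => simp at hl
  | cons g l ih =>
    by_cases h : Gen.c ∈ l
    · obtain ⟨f, h1, h2⟩ := ih h
      obtain ⟨f', h1', h2'⟩ := R.left_step g f
      refine ⟨f', ?_, ?_⟩
      · rw [← h1', ← h1]; simp [qw]
      · intro p
        rw [← h2', ev]; congr 1; funext x; exact h2 x
    · obtain rfl : Gen.c = g := by simpa [h] using hl
      obtain ⟨f, -, h1, h2⟩ := R.right_nf l h
      exact ⟨f, by rw [← h1]; simp [qw, qv], h2⟩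

theorem e_word (R : Rels m A s b d c) (l : List Gen) (hl : Gen.c ∉ l) (x : ZMod (m+3))
    (hx : ev m l (some x) = none) : ee A b x * qw A s b d c l = qw A s b d c l := by
  induction l generalizing x with
  | nil => simp [ev] at hx
  | cons g l ih =>
    have ih := ih (by simp at hl; tauto)
    have hq : qw A s b d c (g :: l) = qv A s b d c g * qw A s b d c l := by simp [qw]
    rw [hq]
    cases g with
    | a1 =>
      have := ih (x+1) (by simpa [ev, gs] using hx)
      have h2 := R.Ae 1 (x+1)
      rw [add_sub_cancel_right] at h2
      rw [qv, ← mul_assoc, ← h2, mul_assoc, this]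
    | a2 =>
      have := ih (Equiv.swap 0 1 x) (by simpa [ev, gs] using hx)
      have h2 : ee A b x * s = s * ee A b (Equiv.swap 0 1 x) := by
        by_cases h0 : x = 0
        · subst h0; rw [Equiv.swap_apply_left, R.se1]
        by_cases h1 : x = 1
        · subst h1; rw [Equiv.swap_apply_right, R.se0]
        rw [Equiv.swap_apply_of_ne_of_ne h0 h1]
        have := R.sge 0 x h0 (by simpa using h1)
        rw [R.sg0] at this
        exact this.symm
      rw [qv, ← mul_assoc, h2, mul_assoc, this]
    | b1 =>
      rw [qv]
      by_cases h : x = -1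
      · subst h; rw [R.em1, ← mul_assoc, R.bb]
      · have := ih x (by simpa [ev, gs, h] using hx)
        have h2 := R.ecomm x (-1)
        rw [R.em1] at h2
        rw [← mul_assoc, h2, mul_assoc, this]
    | b2 =>
      have := ih x (by simpa [ev, gs] using hx)
      rw [qv, ← mul_assoc, ← R.de, mul_assoc, this]
    | c => simp at hl

end Rels

namespace Rels

variable {m : ℕ} {M : Type*} [Monoid M] {A : ZMod (m+3) → M} {s b d c : M}

theorem qw_append (l l' : List Gen) :
    qw A s b d c (l ++ l') = qw A s b d c l * qw A s b d c l' := by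
  simp [qw]

theorem qw_rep (R : Rels m A s b d c) (k : ℕ) :
    qw A s b d c (List.replicate k Gen.a1) = A (k : ZMod (m+3)) := by
  induction k with
  | zero => simp [qw, R.A0]
  | succ k ih =>
    rw [List.replicate_succ', qw_append, ih, Nat.cast_succ, R.Aadd]
    simp [qw, qv]

theorem ev_rep_none (m : ℕ) (k : ℕ) : ev m (List.replicate k Gen.a1) none = some none := by
  induction k with
  | zero => rfl
  | succ k ih => rw [List.replicate_succ, ev]; simpa [gs] using ih

theorem ev_rep_some (m : ℕ) (k : ℕ) (x : ZMod (m+3)) :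
    ev m (List.replicate k Gen.a1) (some x) = some (some (x + k)) := by
  induction k generalizing x with
  | zero => simp [ev]
  | succ k ih =>
    rw [List.replicate_succ, ev]
    simp only [gs, Option.bind_some]
    rw [ih]
    congr 2; push_cast; ring

/-- words of small rank without `c` can be rewritten to contain `c` -/
theorem insert_c (R : Rels m A s b d c) (l : List Gen) (hl : Gen.c ∉ l) (i : ZMod (m+3))
    (hi : ∀ x, x ≠ i → ev m l (some x) = none) :
    ∃ l', Gen.c ∈ l' ∧ qw A s b d c l' = qw A s b d c l ∧ ev m l' = ev m l := by
  refine ⟨List.replicate (-i).val Gen.a1 ++ ([Gen.c, Gen.c] ++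
    (List.replicate i.val Gen.a1 ++ l)), by simp, ?_, ?_⟩
  · rw [qw_append, qw_append, qw_append, R.qw_rep, R.qw_rep, ZMod.natCast_zmod_val,
      ZMod.natCast_zmod_val]
    have : qw A s b d c [Gen.c, Gen.c] = c * c := by simp [qw, qv]
    rw [this, R.ccw, R.AnAw]
    intro x hx
    have h := R.Ae i (x + i)
    rw [add_sub_cancel_right] at h
    rw [← mul_assoc, ← h, mul_assoc, R.e_word l hl]
    apply hi
    intro h; apply hx; linear_combination h
  · funext p
    rw [ev_append]
    rcases p with _ | x
    · rw [ev_rep_none]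
      simp [ev, gs, ev_append, ev_rep_none]
    · rw [ev_rep_some, ZMod.natCast_zmod_val]
      by_cases h : x = i
      · subst h
        simp [ev, gs, ev_append, ev_rep_some]
      · have : x + -i ≠ 0 := by rwa [← sub_eq_add_neg, sub_ne_zero]
        rw [hi x h]
        simp [ev, gs, this]

theorem main (R : Rels m A s b d c) (l1 l2 : List Gen) (h1 : Gen.c ∈ l1)
    (h : ev m l1 = ev m l2) : qw A s b d c l1 = qw A s b d c l2 := by
  obtain ⟨f, hf, hfs⟩ := R.word_nf l1 h1
  obtain ⟨l3, hc, hq, he⟩ : ∃ l', Gen.c ∈ l' ∧ qw A s b d c l' = qw A s b d c l2 ∧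
      ev m l' = ev m l2 := by
    by_cases h2 : Gen.c ∈ l2
    · exact ⟨l2, h2, rfl, rfl⟩
    · apply R.insert_c l2 h2 f.leaf
      intro x hx
      rw [← h, hfs, f.sem_leaf x hx]
  obtain ⟨g, hg, hgs⟩ := R.word_nf l3 hc
  have : f = g := by
    apply NF.sem_inj
    funext p
    rw [← hfs, ← hgs, he, h]
  rw [hf, ← hq, hg, this]

end Rels

/-! ### Connection with the partial maps -/

/-- vertices -/
def pt (m : ℕ) : Option (ZMod (m+3)) → Fin (m+4)
  | none => ⟨0, by omega⟩
  | some x => ⟨x.val + 1, by have := ZMod.val_lt x; omega⟩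

theorem pt_inj (m : ℕ) : Function.Injective (pt m) := by
  rintro (_ | x) (_ | y) h
  · rfl
  · simp [pt] at h
  · simp [pt] at h
  · simp only [pt, Fin.mk.injEq, Nat.add_right_cancel_iff] at h
    rw [ZMod.val_injective _ h]

theorem val_eq_last (m : ℕ) (x : ZMod (m+3)) : x = -1 ↔ x.val = m + 2 := by
  have h : (-1 : ZMod (m+3)).val = m + 2 := ZMod.val_neg_one (m+2)
  constructor
  · rintro rfl; exact h
  · intro hx; exact ZMod.val_injective _ (hx.trans h.symm)

theorem val_eq_one (m : ℕ) (x : ZMod (m+3)) : x = 1 ↔ x.val = 1 := by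
  have h : (1 : ZMod (m+3)).val = 1 := ZMod.val_one'' (by omega)
  constructor
  · rintro rfl; exact h
  · intro hx; exact ZMod.val_injective _ (hx.trans h.symm)

theorem val_succ (m : ℕ) (x : ZMod (m+3)) (h : x ≠ -1) : (x+1).val = x.val + 1 := by
  rw [Ne, val_eq_last] at h
  have := ZMod.val_lt x
  rw [ZMod.val_add, (val_eq_one m 1).1 rfl, Nat.mod_eq_of_lt (by omega)]

theorem genMap_pt (m : ℕ) (hn : 3 ≤ m + 4) (g : Gen) (p : Option (ZMod (m+3))) :
    genMap (m+4) hn g (pt m p) = Part.ofOption ((gs m g p).map (pt m)) := by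
  cases g with
  | a1 =>
    rcases p with _ | x
    · simp [genMap, alphaOne, pt, gs]
    · by_cases h : x = -1
      · have := (val_eq_last m x).1 h
        simp [genMap, alphaOne, pt, gs, this, h]
      · have h' := h
        rw [val_eq_last] at h'
        simp [genMap, alphaOne, pt, gs, h', val_succ m x h]
  | a2 =>
    have v1 := (val_eq_one m 1).1 rfl
    rcases p with _ | x
    · simp [genMap, alphaTwo, pt, gs]
    · by_cases h0 : x = 0
      · subst h0; simp [genMap, alphaTwo, pt, gs, v1]
      by_cases h1 : x = 1
      · subst h1; simp [genMap, alphaTwo, pt, gs, v1]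
      have h0' : x.val ≠ 0 := by rwa [Ne, ZMod.val_eq_zero]
      have h1' := h1
      rw [val_eq_one] at h1'
      simp [genMap, alphaTwo, pt, gs, Equiv.swap_apply_of_ne_of_ne h0 h1, h0, h1']
  | b1 =>
    rcases p with _ | x
    · simp [genMap, betaOne, pt, gs]
    · have := ZMod.val_lt x
      by_cases h : x = -1
      · have := (val_eq_last m x).1 h
        simp [genMap, betaOne, pt, gs, this, h]
      · have h' := h
        rw [val_eq_last] at h'
        have h2 : x.val + 1 ≤ m + 2 := by omega
        simp [genMap, betaOne, pt, gs, h, h2]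
  | b2 =>
    rcases p with _ | x
    · simp [genMap, betaTwo, pt, gs]
    · simp [genMap, betaTwo, pt, gs]
  | c =>
    rcases p with _ | x
    · simp [genMap, gammaMap, pt, gs]
    · by_cases h0 : x = 0
      · subst h0; simp [genMap, gammaMap, pt, gs]
      · simp [genMap, gammaMap, pt, gs, h0]

theorem phi_pt (m : ℕ) (hn : 3 ≤ m + 4) (l : List Gen) (p : Option (ZMod (m+3))) :
    phi (m+4) hn (FreeMonoid.ofList l) (pt m p) = Part.ofOption ((ev m l p).map (pt m)) := by
  induction l generalizing p with
  | nil =>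
    rw [FreeMonoid.ofList_nil, map_one]
    simp [ev]
    rfl
  | cons g l ih =>
    rw [FreeMonoid.ofList_cons, map_mul]
    have h1 : phi (m+4) hn (FreeMonoid.of g) = genMap (m+4) hn g := by simp [phi]
    rw [h1]
    change (genMap (m+4) hn g (pt m p)).bind (phi (m+4) hn (FreeMonoid.ofList l)) = _
    rw [genMap_pt, ev]
    cases hg : gs m g p with
    | none => exact Part.bind_none _
    | some q =>
      simp only [Option.map_some, Part.coe_some, Option.bind_some]
      exact (Part.bind_some _ _).trans (ih q)

theorem ev_of_phi (m : ℕ) (hn : 3 ≤ m + 4) (l1 l2 : List Gen)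
    (h : phi (m+4) hn (FreeMonoid.ofList l1) = phi (m+4) hn (FreeMonoid.ofList l2)) :
    ev m l1 = ev m l2 := by
  funext p
  have h2 := congrFun h (pt m p)
  rw [phi_pt, phi_pt] at h2
  apply Option.map_injective (pt_inj m)
  generalize (ev m l1 p).map (pt m) = o1 at h2 ⊢
  generalize (ev m l2 p).map (pt m) = o2 at h2 ⊢
  ext a
  have h3 : ∀ a, a ∈ o1 ↔ a ∈ o2 := by
    intro a
    rw [← Part.mem_coe, ← Part.mem_coe, h2]
  exact h3 a

theorem rels_quot (m : ℕ) :
    let q : W →* (conGen (Rrel (m+4))).Quotient := (conGen (Rrel (m+4))).mk'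
    Rels m (fun x => q wa1 ^ x.val) (q wa2) (q wb1) (q wb2) (q wc) := by
  intro q
  have rel : ∀ u v, Rrel (m+4) u v → q u = q v := by
    intro u v h
    exact (Con.eq _).2 (ConGen.Rel.of _ _ h)
  have hN : q wa1 ^ (m+3) = 1 := by
    have := rel (wa1 ^ (m+3)) 1 (by
        unfold Rrel
        iterate 1 right
        left
        exact ⟨rfl, rfl⟩)
    simpa using this
  have v1 : (1 : ZMod (m+3)).val = 1 := (val_eq_one m 1).1 rfl
  have vm1 : (-1 : ZMod (m+3)).val = m + 2 := (val_eq_last m _).1 rfl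
  have vm3 : (-3 : ZMod (m+3)).val = m := by
    have : (-3 : ZMod (m+3)) = ((m : ℕ) : ZMod (m+3)) := by
      have h : ((m + 3 : ℕ) : ZMod (m+3)) = 0 := ZMod.natCast_self _
      push_cast at h
      linear_combination -h
    rw [this, ZMod.val_natCast, Nat.mod_eq_of_lt (by omega)]
  have vb : ∀ j : ZMod (m+3), j ≠ 0 → j ≠ 1 → 2 ≤ j.val := by
    intro j h0 h1
    have h0' : j.val ≠ 0 := by rwa [Ne, ZMod.val_eq_zero]
    rw [Ne, val_eq_one] at h1
    omega
  have va : ∀ j : ZMod (m+3), j ≠ 0 → 1 ≤ j.val := by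
    intro j h0
    have h0' : j.val ≠ 0 := by rwa [Ne, ZMod.val_eq_zero]
    omega
  have vc : ∀ j : ZMod (m+3), j ≠ -1 → j.val ≤ m + 1 := by
    intro j h0
    rw [Ne, val_eq_last] at h0
    have := ZMod.val_lt j
    omega
  have vn : ∀ j : ZMod (m+3), j ≠ 0 → (-j).val = m + 3 - j.val := by
    intro j h0
    rw [ZMod.neg_val, if_neg h0]
  constructor
  · simp
  · intro x y
    change q wa1 ^ (x + y).val = q wa1 ^ x.val * q wa1 ^ y.val
    rw [← pow_add, ZMod.val_add]
    exact (pow_eq_pow_mod _ hN).symm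
  · have := rel (wa2 ^ 2) 1 (by
        unfold Rrel
        left
        exact ⟨rfl, rfl⟩)
    simpa [pow_two] using this
  · intro j h0 h1 h2
    have := rel ((wa2 * wa1 ^ (m + 4 - 1 - j.val) * wa2 * wa1 ^ j.val) ^ 2) 1
      (by
        unfold Rrel
        iterate 4 right
        left
        exact ⟨j.val, vb j h0 h1, vc j h2, rfl, rfl⟩)
    simp only [vn j h0]
    simpa using this
  · have := rel (wb1 ^ 2) wb1 (by
        unfold Rrel
        iterate 5 right
        left
        exact ⟨rfl, rfl⟩)
    simpa [pow_two] using this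
  · have := rel (wb2 ^ 2) wb2 (by
        unfold Rrel
        iterate 6 right
        left
        exact ⟨rfl, rfl⟩)
    simpa [pow_two] using this
  · have := rel (wa2 * wb1) (wb1 * wa2) (by
        unfold Rrel
        iterate 7 right
        left
        exact ⟨rfl, rfl⟩)
    simpa using this
  · have := rel (wb2 * wa2) (wa2 * wb2) (by
        unfold Rrel
        iterate 8 right
        left
        exact ⟨rfl, rfl⟩)
    simpa using this
  · have := rel (wb2 * wa1) (wa1 * wb2) (by
        unfold Rrel
        iterate 9 right
        left
        exact ⟨rfl, rfl⟩)
    simpa [v1] using this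
  · have := rel (wb2 * wb1) (wb1 * wb2) (by
        unfold Rrel
        iterate 10 right
        left
        exact ⟨rfl, rfl⟩)
    simpa using this
  · have := rel (wa1 * wa2 * wa1 ^ (m+4 - 2) * wb1 * wa1 * wa2 * wa1 ^ (m+4 - 2))
      (wa1 ^ (m+4 - 2) * wb1 * wa1) (by
        unfold Rrel
        iterate 11 right
        left
        exact ⟨rfl, rfl⟩)
    simpa [v1, vm1] using this
  · have := rel ((wa1 ^ (m+4 - 2) * wb1 * wa1 * wa2) ^ 2)
      ((wa2 * wa1 ^ (m+4 - 2) * wb1 * wa1) ^ 2) (by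
        unfold Rrel
        iterate 12 right
        left
        exact ⟨rfl, rfl⟩)
    simpa [v1, vm1] using this
  · have := rel (wa1 ^ (m+4 - 2) * wb1 * wa1 * wa2 * wa1 ^ (m+4 - 2) * wb1 * wa1)
      ((wa2 * wa1 ^ (m+4 - 2) * wb1 * wa1) ^ 2) (by
        unfold Rrel
        iterate 13 right
        left
        exact ⟨rfl, rfl⟩)
    simpa [v1, vm1] using this
  · have := rel (wc ^ 3) wc (by
        unfold Rrel
        iterate 14 right
        left
        exact ⟨rfl, rfl⟩)
    simpa using this
  · have := rel (wc * wa1) (wc * wa2) (by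
        unfold Rrel
        iterate 15 right
        left
        exact ⟨rfl, rfl⟩)
    simpa [v1] using this
  · have := rel (wa1 ^ (m+4 - 2) * wc) (wa2 * wc) (by
        unfold Rrel
        iterate 16 right
        left
        exact ⟨rfl, rfl⟩)
    simpa [vm1] using this
  · intro j h0 h1
    have := rel (wa2 * wa1 ^ j.val * wc) (wa1 ^ j.val * wc)
      (by
        unfold Rrel
        iterate 17 right
        left
        exact ⟨j.val, va j h0, vc j h1, rfl, rfl⟩)
    simpa using this
  · have := rel (wb1 * wa1 * wc) (wc * wb2) (by
        unfold Rrel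
        iterate 18 right
        left
        exact ⟨rfl, rfl⟩)
    simpa [v1] using this
  · intro j h0 h1 h2
    have := rel (wb1 * wa1 ^ j.val * wc) (wa1 ^ j.val * wc)
      (by
        unfold Rrel
        iterate 19 right
        left
        exact ⟨j.val, vb j h0 h1, vc j h2, rfl, rfl⟩)
    simpa using this
  · have := rel ((wb1 * wa1) ^ (m+4 - 3) * wb1) (wc ^ 2 * wa2 * wa1 ^ (m+4 - 4))
      (by
        unfold Rrel
        iterate 20 right
        left
        exact ⟨rfl, rfl⟩)
    simpa [v1, vm3] using this
  · have := rel (wb2 * wc ^ 2) (wc * wa2 * wc) (by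
        unfold Rrel
        iterate 21 right
        left
        exact ⟨rfl, rfl⟩)
    simpa using this
  · have := rel ((wb2 * wc) ^ 2) (wb2 * wc * wb2) (by
        unfold Rrel
        iterate 22 right
        exact ⟨rfl, rfl⟩)
    simpa using this

theorem statement18 (n : ℕ) (hn : 4 ≤ n) (w1 w2 : W)
    (h1 : 1 ≤ cnt Gen.c w1)
    (hpar : cnt Gen.c w1 % 2 = cnt Gen.c w2 % 2)
    (h : phi n (by omega) w1 = phi n (by omega) w2) :
    conGen (Rrel n) w1 w2 := by
  obtain ⟨m, rfl⟩ : ∃ m, n = m + 4 := ⟨n - 4, by omega⟩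
  have hR := rels_quot m
  set q : W →* (conGen (Rrel (m+4))).Quotient := (conGen (Rrel (m+4))).mk' with hq
  have key := hR.main (FreeMonoid.toList w1) (FreeMonoid.toList w2)
    (List.count_pos_iff.1 h1) (ev_of_phi m (by omega) _ _ h)
  have hw : ∀ l : List Gen, qw (m := m) (fun x => q wa1 ^ x.val) (q wa2) (q wb1) (q wb2) (q wc) l
      = q (FreeMonoid.ofList l) := by
    intro l
    induction l with
    | nil => rw [FreeMonoid.ofList_nil, map_one]; simp [qw]
    | cons g l ih =>
      rw [FreeMonoid.ofList_cons, map_mul, ← ih]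
      simp only [qw, List.map_cons, List.prod_cons]
      congr 1
      cases g <;> simp only [qv]
      · rw [(val_eq_one m 1).1 rfl, pow_one]; rfl
      all_goals rfl
  rw [hw, hw] at key
  exact (Con.eq _).1 key

end DPSPaper
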